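/- arXiv:1011.0395 — 2 statements merged into one kernel-verified Lean document; each statement's English description precedes it below -/
import Mathlib

section
/- Let π and σ be the permutations of {1,…,7} determined by the bottom-line words (7,6,5,4,3,2,1) and (4,3,5,7,6,2,1) respectively. Both are irreducible and their extended Rauzy classes are distinct: σ ∉ R_ex(π). (These two extended Rauzy classes correspond to the hyperelliptic and odd-spin connected components of the stratum H(2,2).) -/
/-- The auxiliary permutation `q m` of `Fin n` (`0`-indexed version of the
renumbering used in the Rauzy operations): it fixes every `j ≤ m`, sends
`j ↦ j + 1` for `m < j < n - 1`, and sends the last index `n - 1` to `m + 1`.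
(When `m = n - 1` it is the identity.) -/
def rauzyQ {n : ℕ} (m : Fin n) : Equiv.Perm (Fin n) :=
  (Fin.revPerm * Fin.cycleRange ⟨n - 2 - m.val, by have := m.isLt; omega⟩ * Fin.revPerm)⁻¹

/-- Rauzy operation `a`: in the two-line representation of `π` (top line
`(0, …, n-1)`, bottom line `(π⁻¹ 0, …, π⁻¹ (n-1))`) one deletes the last entry
of the bottom line and reinserts it immediately to the right of the entry
`n - 1` of the bottom line.  In terms of permutations this is
`a(π) = q (π (n-1)) ∘ π`. -/
def rauzyA {n : ℕ} (π : Equiv.Perm (Fin n)) : Equiv.Perm (Fin n) :=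
  if h : n = 0 then π else rauzyQ (π ⟨n - 1, by omega⟩) * π

/-- Rauzy operation `b`: one deletes the last entry `n - 1` of the top line,
reinserts it immediately to the right of the entry `π⁻¹ (n-1)` of the top line
and relabels the symbols in the order of their appearance in the new top line.
In terms of permutations the relabelling map is `r = q (π⁻¹ (n-1))` and
`b(π) = π ∘ r⁻¹`. -/
def rauzyB {n : ℕ} (π : Equiv.Perm (Fin n)) : Equiv.Perm (Fin n) :=
  if h : n = 0 then π else π * (rauzyQ (π⁻¹ ⟨n - 1, by omega⟩))⁻¹

/-- Operation `c`: reverse the order of the entries in each line, interchange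
the two lines and relabel so that the top line is again `(0, …, n-1)`.
In terms of permutations, `c(π) = w ∘ π⁻¹ ∘ w` where `w : j ↦ n - 1 - j`. -/
def rauzyC {n : ℕ} (π : Equiv.Perm (Fin n)) : Equiv.Perm (Fin n) :=
  Fin.revPerm * π⁻¹ * Fin.revPerm

/-- A permutation of `{0, …, n-1}` is irreducible if it maps no proper initial
segment `{0, …, k}` (with `k < n - 1`) to itself. -/
def IrreduciblePerm {n : ℕ} (π : Equiv.Perm (Fin n)) : Prop :=
  ∀ k : ℕ, k + 1 < n → ¬ (∀ i : Fin n, i.val ≤ k → (π i).val ≤ k)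

/-- The Rauzy class of `π`: the smallest set of permutations containing `π`
and closed under the Rauzy operations `a` and `b`. -/
def RauzyClass {n : ℕ} (π : Equiv.Perm (Fin n)) : Set (Equiv.Perm (Fin n)) :=
  {σ | ∀ S : Set (Equiv.Perm (Fin n)), π ∈ S →
    (∀ τ ∈ S, rauzyA τ ∈ S) → (∀ τ ∈ S, rauzyB τ ∈ S) → σ ∈ S}

/-- The extended Rauzy class of `π`: the smallest set of permutations
containing `π` and closed under the operations `a`, `b` and `c`. -/
def RauzyClassEx {n : ℕ} (π : Equiv.Perm (Fin n)) : Set (Equiv.Perm (Fin n)) :=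
  {σ | ∀ S : Set (Equiv.Perm (Fin n)), π ∈ S →
    (∀ τ ∈ S, rauzyA τ ∈ S) → (∀ τ ∈ S, rauzyB τ ∈ S) →
    (∀ τ ∈ S, rauzyC τ ∈ S) → σ ∈ S}

/-- The quadratic form over `ZMod 2` attached to the inversion graph of `f`: it takes the value `1`
on each basis vector, and its polar form is the adjacency form of the graph. -/
def arfForm {n : ℕ} (f : Fin n → Fin n) (v : Fin n → ZMod 2) : ZMod 2 :=
  ∑ i, v i + ∑ i, ∑ j, if i < j ∧ f j < f i then v i * v j else 0

/-- The number of zeros of the quadratic form of the inversion graph of `π`. It determines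
the Arf invariant of the form. -/
def arfZeros {n : ℕ} (π : Equiv.Perm (Fin n)) : ℕ :=
  (Finset.univ.filter fun v : Fin n → ZMod 2 => arfForm π v = 0).card

theorem arfZeros_eq_of_equiv {n : ℕ} {π σ : Equiv.Perm (Fin n)}
    (e : (Fin n → ZMod 2) ≃ (Fin n → ZMod 2)) (h : ∀ v, arfForm π v = arfForm σ (e v)) :
    arfZeros π = arfZeros σ :=
  Finset.card_equiv e fun v => by simp [h]

theorem arfForm_inv {n : ℕ} (π : Equiv.Perm (Fin n)) (v : Fin n → ZMod 2) :
    arfForm (π⁻¹ : Equiv.Perm (Fin n)) v = arfForm π (v ∘ π) := by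
  unfold arfForm
  congr 1
  · exact (Equiv.sum_comp π v).symm
  · rw [Finset.sum_comm, ← Equiv.sum_comp π]
    refine Finset.sum_congr rfl fun i _ => ?_
    rw [← Equiv.sum_comp π]
    refine Finset.sum_congr rfl fun j _ => ?_
    simp [and_comm, mul_comm]

theorem arfZeros_inv {n : ℕ} (π : Equiv.Perm (Fin n)) : arfZeros π⁻¹ = arfZeros π :=
  arfZeros_eq_of_equiv (Equiv.arrowCongr π⁻¹ (Equiv.refl _)) fun v => arfForm_inv π v

theorem arfForm_rev_conj {n : ℕ} (π : Equiv.Perm (Fin n)) (v : Fin n → ZMod 2) :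
    arfForm (Fin.revPerm * π * Fin.revPerm : Equiv.Perm (Fin n)) v =
      arfForm π (v ∘ Fin.revPerm) := by
  unfold arfForm
  congr 1
  · exact (Equiv.sum_comp Fin.revPerm v).symm
  · rw [Finset.sum_comm, ← Equiv.sum_comp Fin.revPerm]
    refine Finset.sum_congr rfl fun i _ => ?_
    rw [← Equiv.sum_comp Fin.revPerm]
    refine Finset.sum_congr rfl fun j _ => ?_
    simp [mul_comm]

theorem arfZeros_rauzyC {n : ℕ} (π : Equiv.Perm (Fin n)) :
    arfZeros (rauzyC π) = arfZeros π := by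
  rw [← arfZeros_inv π]
  exact arfZeros_eq_of_equiv (Equiv.arrowCongr Fin.revPerm (Equiv.refl _)) fun v =>
    arfForm_rev_conj π⁻¹ v

theorem rauzyQ_val {n : ℕ} (m j : Fin n) :
    (rauzyQ m j).val =
      if j ≤ m then j.val else if j.val = n - 1 then m.val + 1 else j.val + 1 := by
  have hj := j.isLt
  have hm := m.isLt
  suffices h : ∀ k : Fin n, k.val =
      (if j ≤ m then j.val else if j.val = n - 1 then m.val + 1 else j.val + 1) →
      rauzyQ m j = k by
    have hlt : (if j ≤ m then j.val else if j.val = n - 1 then m.val + 1 else j.val + 1) < n := by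
      split_ifs <;> simp only [Fin.le_def] at * <;> omega
    rw [h ⟨_, hlt⟩ rfl]
  intro k hk
  have : NeZero n := ⟨by omega⟩
  rw [rauzyQ, Equiv.Perm.inv_eq_iff_eq]
  simp only [Equiv.Perm.mul_apply, Fin.revPerm_apply, Fin.cycleRange_apply]
  ext
  simp only [Fin.lt_def, Fin.le_def, Fin.ext_iff, Fin.val_rev] at *
  have hs : k.rev.val + 1 < n → (k.rev + 1).val = k.rev.val + 1 := Fin.val_add_one_of_lt'
  have h0 : (0 : Fin n).val = 0 := rfl
  simp only [Fin.val_rev] at hs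
  split_ifs at * <;> first | omega | (simp only [Fin.val_rev]; omega)

/-- Adding a multiple of the last basis vector changes the form by the corresponding
polar term. -/
theorem arfForm_update_last {n : ℕ} (f : Fin (n + 1) → Fin (n + 1)) (v : Fin (n + 1) → ZMod 2)
    (c : ZMod 2) :
    arfForm f (Function.update v (Fin.last n) (v (Fin.last n) + c)) =
      arfForm f v + c + c * ∑ j, if f (Fin.last n) < f j then v j else 0 := by
  have hlast : ∀ i : Fin n, ¬ Fin.last n < i.castSucc := fun i => (Fin.le_last _).not_gt
  simp only [arfForm, Fin.sum_univ_castSucc, Finset.sum_add_distrib, Finset.mul_sum,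
    Fin.castSucc_lt_last, Function.update_self, ne_eq, Fin.castSucc_ne_last, not_false_eq_true,
    Function.update_of_ne, hlast, lt_self_iff_false, false_and, true_and, if_false,
    Finset.sum_const_zero, mul_ite, mul_add, mul_zero, add_zero]
  have : ∀ i : Fin n, (if f (Fin.last n) < f i.castSucc then
      v i.castSucc * v (Fin.last n) + v i.castSucc * c else 0) =
      (if f (Fin.last n) < f i.castSucc then v i.castSucc * v (Fin.last n) else 0) +
      if f (Fin.last n) < f i.castSucc then c * v i.castSucc else 0 := fun i => by
    split_ifs <;> ring
  simp only [this, Finset.sum_add_distrib]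
  ring

/-- Rauzy operation `a` acts on the form by the elementary substitution that adds the basis
vector of the last letter to that of the letter with the largest image. -/
theorem arfForm_rauzyA {n : ℕ} (π : Equiv.Perm (Fin (n + 1))) (v : Fin (n + 1) → ZMod 2)
    (h : π (Fin.last n) ≠ Fin.last n) :
    arfForm (rauzyA π) v =
      arfForm π (Function.update v (Fin.last n) (v (Fin.last n) + v (π⁻¹ (Fin.last n)))) := by
  obtain ⟨t, ht⟩ := π.surjective (Fin.last n)
  have htinv : π⁻¹ (Fin.last n) = t := by rw [← ht]; simp
  have hval (i : Fin (n + 1)) : (rauzyA π i).val = if π i ≤ π (Fin.last n) then (π i).val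
      else if i = t then (π (Fin.last n)).val + 1 else (π i).val + 1 := by
    have : (π i).val = n ↔ i = t := by
      rw [← π.injective.eq_iff, ht, Fin.ext_iff, Fin.val_last]
    simp only [rauzyA, Nat.add_eq_zero_iff, one_ne_zero, and_false, dite_false,
      Equiv.Perm.mul_apply, rauzyQ_val, Nat.add_sub_cancel, this]
    rfl
  have hm : (π (Fin.last n)).val < n := Fin.val_lt_last h
  have hpair (i j : Fin (n + 1)) :
      (if i < j ∧ rauzyA π j < rauzyA π i then v i * v j else 0) =
        (if i < j ∧ π j < π i then v i * v j else 0) +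
        ((if i = t then if i < j ∧ π (Fin.last n) < π j then v i * v j else 0 else 0) +
        if j = t then if i < j ∧ π (Fin.last n) < π i then v i * v j else 0 else 0) := by
    have hi := hval i
    have hj := hval j
    have hti : i = t ↔ (π i).val = n := by
      rw [← π.injective.eq_iff, ht, Fin.ext_iff, Fin.val_last]
    have htj : j = t ↔ (π j).val = n := by
      rw [← π.injective.eq_iff, ht, Fin.ext_iff, Fin.val_last]
    have hin := (π i).isLt
    have hjn := (π j).isLt
    have hij : i.val = j.val → (π i).val = (π j).val := fun e => by rw [Fin.ext e]
    have two := CharTwo.add_self_eq_zero (v i * v j)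
    simp only [Fin.lt_def, Fin.le_def, hti, htj] at *
    clear hval
    split_ifs at hi hj ⊢ <;> first | omega | simp [two]
  rw [htinv, arfForm_update_last]
  simp only [arfForm, hpair, Finset.sum_add_distrib]
  rw [Finset.sum_comm (f := fun i j => if i = t then _ else _)]
  simp only [Finset.sum_ite_eq', Finset.mem_univ, if_true]
  have hsum : v t + v t * ∑ j, (if π (Fin.last n) < π j then v j else 0) =
      ∑ j, (if t < j ∧ π (Fin.last n) < π j then v t * v j else 0) +
      ∑ i, if i < t ∧ π (Fin.last n) < π i then v i * v t else 0 := by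
    have hsq : v t * v t = v t := by generalize v t = x; revert x; decide
    have hlt : π (Fin.last n) < π t := by rw [ht]; exact hm
    have hpt (j : Fin (n + 1)) :
        ((if t < j ∧ π (Fin.last n) < π j then v t * v j else 0) +
          if j < t ∧ π (Fin.last n) < π j then v j * v t else 0) =
        (if j = t then v t else 0) + v t * if π (Fin.last n) < π j then v j else 0 := by
      rcases lt_trichotomy j t with hj | rfl | hj
      · simp [hj, hj.not_gt, hj.ne, mul_comm]
      · simp [hlt, hsq, CharTwo.add_self_eq_zero]
      · simp [hj, hj.not_gt, hj.ne']
    rw [← Finset.sum_add_distrib, Finset.sum_congr rfl fun j _ => hpt j, Finset.sum_add_distrib,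
      Finset.mul_sum, Finset.sum_ite_eq' Finset.univ t, if_pos (Finset.mem_univ t)]
  rw [← hsum]
  ring

theorem arfZeros_rauzyA {n : ℕ} (π : Equiv.Perm (Fin n)) : arfZeros (rauzyA π) = arfZeros π := by
  cases n with
  | zero => rfl
  | succ n =>
    by_cases h : π (Fin.last n) = Fin.last n
    · congr 1
      ext i
      have : i ≤ Fin.last n := Fin.le_last i
      change (rauzyQ (π (Fin.last n)) (π i)).val = _
      rw [h, rauzyQ_val, if_pos (Fin.le_last _)]
    · have ht : π⁻¹ (Fin.last n) ≠ Fin.last n := fun e => h (Equiv.Perm.inv_eq_iff_eq.1 e).symm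
      have hinv : Function.Involutive fun v : Fin (n + 1) → ZMod 2 =>
          Function.update v (Fin.last n) (v (Fin.last n) + v (π⁻¹ (Fin.last n))) := fun v => by
        simp only [Function.update_self, Function.update_of_ne ht, add_assoc,
          CharTwo.add_self_eq_zero, add_zero, Function.update_idem, Function.update_eq_self]
      exact arfZeros_eq_of_equiv hinv.toPerm fun v => arfForm_rauzyA π v h

theorem rauzyB_eq {n : ℕ} (π : Equiv.Perm (Fin n)) : rauzyB π = (rauzyA π⁻¹)⁻¹ := by
  unfold rauzyA rauzyB
  split_ifs <;> simp

theorem arfZeros_rauzyB {n : ℕ} (π : Equiv.Perm (Fin n)) : arfZeros (rauzyB π) = arfZeros π := by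
  rw [rauzyB_eq, arfZeros_inv, arfZeros_rauzyA, arfZeros_inv]

theorem arfZeros_eq_of_mem_rauzyClassEx {n : ℕ} {π σ : Equiv.Perm (Fin n)}
    (h : σ ∈ RauzyClassEx π) : arfZeros σ = arfZeros π :=
  h {τ | arfZeros τ = arfZeros π} rfl (fun τ hτ => (arfZeros_rauzyA τ).trans hτ)
    (fun τ hτ => (arfZeros_rauzyB τ).trans hτ) fun τ hτ => (arfZeros_rauzyC τ).trans hτ

theorem irreduciblePerm_of_apply_zero {n : ℕ} {π : Equiv.Perm (Fin (n + 1))}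
    (h : π 0 = Fin.last n) : IrreduciblePerm π := by
  intro k hk hmaps
  have := hmaps 0 (Nat.zero_le k)
  rw [h, Fin.val_last] at this
  omega

/-- The permutations of `{1, …, 7}` with bottom lines
`(7,6,5,4,3,2,1)` and `(4,3,5,7,6,2,1)` are irreducible and lie in distinct
extended Rauzy classes (hyperelliptic and odd-spin components of `H(2,2)`). -/
theorem rauzyClassEx_H22_distinct (π σ : Equiv.Perm (Fin 7))
    (hπ : ∀ i, π⁻¹ i = ![6,5,4,3,2,1,0] i)
    (hσ : ∀ i, σ⁻¹ i = ![3,2,4,6,5,1,0] i) :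
    IrreduciblePerm π ∧ IrreduciblePerm σ ∧ σ ∉ RauzyClassEx π := by
  have hπ' : arfForm (π⁻¹ : Equiv.Perm (Fin 7)) = arfForm ![6,5,4,3,2,1,0] :=
    congrArg arfForm (funext hπ)
  have hσ' : arfForm (σ⁻¹ : Equiv.Perm (Fin 7)) = arfForm ![3,2,4,6,5,1,0] :=
    congrArg arfForm (funext hσ)
  have hπ0 : π 0 = 6 := by rw [← Equiv.Perm.eq_inv_iff_eq, hπ]; rfl
  have hσ0 : σ 0 = 6 := by rw [← Equiv.Perm.eq_inv_iff_eq, hσ]; rfl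
  refine ⟨irreduciblePerm_of_apply_zero hπ0, irreduciblePerm_of_apply_zero hσ0, fun h => ?_⟩
  have key : arfZeros σ⁻¹ = arfZeros π⁻¹ := by
    rw [arfZeros_inv, arfZeros_inv]
    exact arfZeros_eq_of_mem_rauzyClassEx h
  simp only [arfZeros, hπ', hσ'] at key
  revert key
  decide +kernel
end

section
/- Let π and σ be the permutations of {1,…,8} determined by the bottom-line words (5,4,3,8,7,6,2,1) and (4,3,5,8,7,6,2,1) respectively. Both are irreducible, they belong to the same extended Rauzy class, R_ex(π) = R_ex(σ), their Rauzy classes are distinct, and the Rauzy class R(π) has exactly 1258 elements while R(σ) has exactly 919 elements. (Both represent the connected stratum H(2,1,1).) -/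
section Encoding

/-- The `i`-th base-`8` digit of `N`. -/
def octalDigit (N i : ℕ) : ℕ := N / 8 ^ i % 8

/-- The number whose eight lowest base-`8` digits are `f 0, …, f 7`. -/
def octal (f : ℕ → ℕ) : ℕ :=
  f 0 + 8 * (f 1 + 8 * (f 2 + 8 * (f 3 + 8 * (f 4 + 8 * (f 5 + 8 * (f 6 + 8 * f 7))))))

theorem octalDigit_octal {f : ℕ → ℕ} (hf : ∀ i < 8, f i < 8) {i : ℕ} (hi : i < 8) :
    octalDigit (octal f) i = f i := by
  have h0 := hf 0; have h1 := hf 1; have h2 := hf 2; have h3 := hf 3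
  have h4 := hf 4; have h5 := hf 5; have h6 := hf 6; have h7 := hf 7
  unfold octalDigit octal
  interval_cases i <;> omega

theorem octal_congr {f g : ℕ → ℕ} (h : ∀ i < 8, f i = g i) : octal f = octal g := by
  simp [octal, h]

/-- The value of `rauzyQ m` at `j`, for permutations of eight letters. -/
def octalShift (m j : ℕ) : ℕ :=
  bif j.ble m then j else bif j.blt 7 then j + 1 else m + 1

/-- The value of `(rauzyQ m)⁻¹` at `j`, for permutations of eight letters. -/
def octalUnshift (m j : ℕ) : ℕ :=
  bif j.ble m then j else bif j.beq (m + 1) then 7 else j - 1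

theorem rauzyQ_val_s12 (m j : Fin 8) : (rauzyQ m j : ℕ) = octalShift m j := by
  revert m j; decide +kernel

theorem rauzyQ_inv_val (m j : Fin 8) : ((rauzyQ m)⁻¹ j : ℕ) = octalUnshift m j := by
  revert m j; decide +kernel

/-- The position of the digit `v` in `N`, provided `v` occurs exactly once. -/
def octalPos (N v : ℕ) : ℕ :=
  let p i := bif (octalDigit N i).beq v then i else 0
  p 0 + p 1 + p 2 + p 3 + p 4 + p 5 + p 6 + p 7

/-- Rauzy operation `a` on codes. -/
def codeA (N : ℕ) : ℕ := octal fun i => octalShift (octalDigit N 7) (octalDigit N i)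

/-- Rauzy operation `b` on codes. -/
def codeB (N : ℕ) : ℕ := octal fun i => octalDigit N (octalUnshift (octalPos N 7) i)

/-- Operation `c` on codes. -/
def codeC (N : ℕ) : ℕ := octal fun i => 7 - octalPos N (7 - i)

/-- The word `π 0, …, π 7` read as a number in base `8`. -/
def permCode (π : Equiv.Perm (Fin 8)) : ℕ := octal fun i => π (Fin.ofNat 8 i)

theorem octalDigit_permCode (π : Equiv.Perm (Fin 8)) (i : Fin 8) :
    octalDigit (permCode π) i = π i := by
  rw [permCode, octalDigit_octal (fun _ _ => (π _).isLt) i.isLt]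
  simp

theorem permCode_injective : Function.Injective permCode := fun π σ h =>
  Equiv.ext fun i => Fin.ext <| by rw [← octalDigit_permCode, h, octalDigit_permCode]

theorem permCode_eq_octal {π : Equiv.Perm (Fin 8)} {f : ℕ → ℕ}
    (h : ∀ i : Fin 8, (π i : ℕ) = f i) : permCode π = octal f :=
  octal_congr fun i hi => by rw [h]; simp [Nat.mod_eq_of_lt hi]

theorem octalPos_permCode (π : Equiv.Perm (Fin 8)) (v : Fin 8) :
    octalPos (permCode π) v = π⁻¹ v := by
  have h (i : Fin 8) : (bif (octalDigit (permCode π) i).beq v then (i : ℕ) else 0) =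
      if i = π⁻¹ v then (i : ℕ) else 0 := by
    simp only [octalDigit_permCode, Equiv.Perm.eq_inv_iff_eq, Bool.cond_eq_ite, Nat.beq_eq,
      Fin.ext_iff]
  have hsum := Finset.sum_congr (rfl : (Finset.univ : Finset (Fin 8)) = _) fun i _ => h i
  rw [Finset.sum_ite_eq' Finset.univ (π⁻¹ v) (fun i : Fin 8 => (i : ℕ)), Fin.sum_univ_eight] at hsum
  simpa [octalPos] using hsum

theorem permCode_rauzyA (π : Equiv.Perm (Fin 8)) :
    permCode (rauzyA π) = codeA (permCode π) :=
  permCode_eq_octal fun i => by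
    rw [octalDigit_permCode, show (7 : ℕ) = (7 : Fin 8) from rfl, octalDigit_permCode,
      ← rauzyQ_val_s12]
    rfl

theorem permCode_rauzyB (π : Equiv.Perm (Fin 8)) :
    permCode (rauzyB π) = codeB (permCode π) :=
  permCode_eq_octal fun i => by
    rw [show (7 : ℕ) = (7 : Fin 8) from rfl, octalPos_permCode, ← rauzyQ_inv_val,
      octalDigit_permCode]
    rfl

theorem permCode_rauzyC (π : Equiv.Perm (Fin 8)) :
    permCode (rauzyC π) = codeC (permCode π) :=
  permCode_eq_octal fun i => by
    have h : 7 - (i : ℕ) = (Fin.rev i : Fin 8) := by simp [Fin.val_rev]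
    rw [h, octalPos_permCode]
    simp [rauzyC, Fin.val_rev]

end Encoding

section Exploration

/-- Depth-first search along `codeA` and `codeB`: the given number of steps, starting from a
stack of codes still to be visited and the set of codes visited so far. -/
def exploreCodes : ℕ → List ℕ → Std.TreeSet ℕ → Std.TreeSet ℕ
  | 0, _, t => t
  | _, [], t => t
  | n + 1, x :: l, t =>
    bif t.contains x then exploreCodes n l t
    else exploreCodes n (codeA x :: codeB x :: l) (t.insert x)

theorem forall_mem_exploreCodes {P : ℕ → Prop} (hA : ∀ x, P x → P (codeA x))
    (hB : ∀ x, P x → P (codeB x)) (n : ℕ) (l : List ℕ) (t : Std.TreeSet ℕ)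
    (hl : ∀ x ∈ l, P x) (ht : ∀ x ∈ t, P x) : ∀ x ∈ exploreCodes n l t, P x := by
  induction n generalizing l t with
  | zero => simpa [exploreCodes] using ht
  | succ n ih =>
    cases l with
    | nil => simpa [exploreCodes] using ht
    | cons x l =>
      rw [List.forall_mem_cons] at hl
      rw [exploreCodes, Bool.cond_eq_ite]
      split_ifs
      · exact ih l t hl.2 ht
      · refine ih _ _ (by simpa using ⟨hA x hl.1, hB x hl.1, hl.2⟩) fun y hy => ?_
        rcases Std.TreeSet.mem_insert.mp hy with h | h
        · rw [← Nat.compare_eq_eq.mp h]; exact hl.1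
        · exact ht y h

/-- The set of codes contains `N`, is closed under `codeA` and `codeB`, and has `k` elements. -/
def isClosedCodeSet (N k : ℕ) (t : Std.TreeSet ℕ) : Bool :=
  t.contains N && t.toList.all (fun x => t.contains (codeA x) && t.contains (codeB x)) &&
    t.size.beq k

theorem ncard_setOf_mem_treeSet (t : Std.TreeSet ℕ) : {x | x ∈ t}.ncard = t.size := by
  have hnodup : t.toList.Nodup :=
    t.distinct_toList.imp fun h hxy => h (Nat.compare_eq_eq.mpr hxy)
  have hset : {x | x ∈ t} = (t.toList.toFinset : Set ℕ) := by
    ext x; simp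
  rw [hset, Set.ncard_coe_finset, List.toFinset_card_of_nodup hnodup, Std.TreeSet.length_toList]

end Exploration

section Classes

variable {n : ℕ} {π σ τ : Equiv.Perm (Fin n)}

theorem self_mem_rauzyClass : π ∈ RauzyClass π := fun _ h _ _ => h

theorem rauzyA_mem_rauzyClass (h : τ ∈ RauzyClass π) : rauzyA τ ∈ RauzyClass π :=
  fun S hπ hA hB => hA τ (h S hπ hA hB)

theorem rauzyB_mem_rauzyClass (h : τ ∈ RauzyClass π) : rauzyB τ ∈ RauzyClass π :=
  fun S hπ hA hB => hB τ (h S hπ hA hB)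

theorem self_mem_rauzyClassEx : π ∈ RauzyClassEx π := fun _ h _ _ _ => h

theorem rauzyA_mem_rauzyClassEx (h : τ ∈ RauzyClassEx π) : rauzyA τ ∈ RauzyClassEx π :=
  fun S hπ hA hB hC => hA τ (h S hπ hA hB hC)

theorem rauzyB_mem_rauzyClassEx (h : τ ∈ RauzyClassEx π) : rauzyB τ ∈ RauzyClassEx π :=
  fun S hπ hA hB hC => hB τ (h S hπ hA hB hC)

theorem rauzyC_mem_rauzyClassEx (h : τ ∈ RauzyClassEx π) : rauzyC τ ∈ RauzyClassEx π :=
  fun S hπ hA hB hC => hC τ (h S hπ hA hB hC)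

theorem rauzyClassEx_subset (h : σ ∈ RauzyClassEx π) : RauzyClassEx σ ⊆ RauzyClassEx π :=
  fun _ hτ => hτ _ h (fun _ => rauzyA_mem_rauzyClassEx) (fun _ => rauzyB_mem_rauzyClassEx)
    fun _ => rauzyC_mem_rauzyClassEx

end Classes

theorem ncard_rauzyClass_of_isClosedCodeSet {π : Equiv.Perm (Fin 8)} {m k : ℕ}
    (h : isClosedCodeSet (permCode π) k (exploreCodes m [permCode π] ∅) = true) :
    (RauzyClass π).ncard = k := by
  set t := exploreCodes m [permCode π] ∅
  simp only [isClosedCodeSet, Bool.and_eq_true, List.all_eq_true, Std.TreeSet.mem_toList,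
    Std.TreeSet.contains_iff_mem, Nat.beq_eq] at h
  obtain ⟨⟨hπ, hclosed⟩, hsize⟩ := h
  have himage : permCode '' RauzyClass π = {x | x ∈ t} := by
    apply Set.Subset.antisymm
    · rintro _ ⟨τ, hτ, rfl⟩
      exact hτ {τ | permCode τ ∈ t} hπ
        (fun τ hτ => show permCode (rauzyA τ) ∈ t from permCode_rauzyA τ ▸ (hclosed _ hτ).1)
        (fun τ hτ => show permCode (rauzyB τ) ∈ t from permCode_rauzyB τ ▸ (hclosed _ hτ).2)
    · refine forall_mem_exploreCodes (P := (· ∈ permCode '' RauzyClass π)) ?_ ?_ m _ _ ?_ ?_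
      · rintro _ ⟨τ, hτ, rfl⟩
        exact ⟨_, rauzyA_mem_rauzyClass hτ, permCode_rauzyA τ⟩
      · rintro _ ⟨τ, hτ, rfl⟩
        exact ⟨_, rauzyB_mem_rauzyClass hτ, permCode_rauzyB τ⟩
      · simpa using ⟨π, self_mem_rauzyClass, rfl⟩
      · simp
  rw [← Set.ncard_image_of_injective _ permCode_injective, himage, ncard_setOf_mem_treeSet, hsize]

/-- The operation on codes with the given index: `0`, `1`, `2` stand for `a`, `b`, `c`. -/
def codeStep (N : ℕ) : Fin 3 → ℕ := ![codeA N, codeB N, codeC N]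

theorem exists_mem_rauzyClassEx_permCode_eq (π : Equiv.Perm (Fin 8)) (w : List (Fin 3)) :
    ∃ τ ∈ RauzyClassEx π, permCode τ = w.foldl codeStep (permCode π) := by
  induction w using List.reverseRecOn with
  | nil => exact ⟨π, self_mem_rauzyClassEx, rfl⟩
  | append_singleton w i ih =>
    obtain ⟨τ, hτ, h⟩ := ih
    rw [List.foldl_append, ← h]
    fin_cases i
    · exact ⟨_, rauzyA_mem_rauzyClassEx hτ, permCode_rauzyA τ⟩
    · exact ⟨_, rauzyB_mem_rauzyClassEx hτ, permCode_rauzyB τ⟩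
    · exact ⟨_, rauzyC_mem_rauzyClassEx hτ, permCode_rauzyC τ⟩

theorem mem_rauzyClassEx_of_foldl {π σ : Equiv.Perm (Fin 8)} (w : List (Fin 3))
    (h : w.foldl codeStep (permCode π) = permCode σ) : σ ∈ RauzyClassEx π := by
  obtain ⟨τ, hτ, hw⟩ := exists_mem_rauzyClassEx_permCode_eq π w
  exact permCode_injective (hw.trans h) ▸ hτ

theorem eq_of_inv_eq {α : Type*} {π : Equiv.Perm α} {f g : α → α} (h : ∀ i, π⁻¹ i = f i)
    (hfg : ∀ i, f (g i) = i) (i : α) : π i = g i := by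
  rw [← Equiv.Perm.eq_inv_iff_eq, h, hfg]

/-- The permutations of `{1, …, 8}` with bottom lines
`(5,4,3,8,7,6,2,1)` and `(4,3,5,8,7,6,2,1)` are irreducible, have the same
extended Rauzy class, distinct Rauzy classes, and their Rauzy classes have
exactly `1258` and `919` elements respectively (stratum `H(2,1,1)`). -/
theorem rauzyClass_H211_two_classes (π σ : Equiv.Perm (Fin 8))
    (hπ : ∀ i, π⁻¹ i = ![4,3,2,7,6,5,1,0] i)
    (hσ : ∀ i, σ⁻¹ i = ![3,2,4,7,6,5,1,0] i) :
    IrreduciblePerm π ∧ IrreduciblePerm σ ∧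
      RauzyClassEx π = RauzyClassEx σ ∧ RauzyClass π ≠ RauzyClass σ ∧
      (RauzyClass π).ncard = 1258 ∧ (RauzyClass σ).ncard = 919 := by
  have hπ' := eq_of_inv_eq (g := ![7, 6, 2, 1, 0, 5, 4, 3]) hπ (by decide)
  have hσ' := eq_of_inv_eq (g := ![7, 6, 1, 0, 2, 5, 4, 3]) hσ (by decide)
  have hπc : permCode π = 7504567 := by
    simp only [permCode, octal, hπ']
    rfl
  have hσc : permCode σ = 7512183 := by
    simp only [permCode, octal, hσ']
    rfl
  have hπn : (RauzyClass π).ncard = 1258 := by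
    apply ncard_rauzyClass_of_isClosedCodeSet (m := 2600)
    rw [hπc]
    decide +kernel
  have hσn : (RauzyClass σ).ncard = 919 := by
    apply ncard_rauzyClass_of_isClosedCodeSet (m := 2600)
    rw [hσc]
    decide +kernel
  refine ⟨?_, ?_, Set.Subset.antisymm (rauzyClassEx_subset ?_) (rauzyClassEx_subset ?_),
    fun h => ?_, hπn, hσn⟩
  · intro k hk
    have : k < 7 := by omega
    simp only [hπ']
    interval_cases k <;> decide
  · intro k hk
    have : k < 7 := by omega
    simp only [hσ']
    interval_cases k <;> decide
  · apply mem_rauzyClassEx_of_foldl [1, 0, 1, 1, 1, 0, 1, 0, 2, 1, 0, 1, 0, 1, 2, 1]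
    rw [hπc, hσc]
    decide +kernel
  · apply mem_rauzyClassEx_of_foldl [1, 0, 1, 1, 0, 1, 0, 1, 0, 0, 2, 1, 0, 0, 2]
    rw [hπc, hσc]
    decide +kernel
  · rw [h, hσn] at hπn
    omega
end
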